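/- Let f ∈ ℋ and h > 0. Then for every s ∈ ℂ and t > 0 the Newton series (E^h f_s)(t) = Σ_{n=0}^∞ binom(h,n) (Δ^n f_s)(t) converges absolutely and locally uniformly in t and equals f(s, t+h). -/

import Mathlib

open MeasureTheory Filter Set

noncomputable section

/-- The Laplace transform `ℒ(φ)(t) = ∫₀^∞ e^{−tu} φ(u) du`. -/
def Lap (φ : ℝ → ℂ) (t : ℝ) : ℂ :=
  ∫ u in Ioi (0:ℝ), Complex.exp (-(t * u : ℝ)) * φ u

/-- Membership in the domain `𝒟(ℒ)` of the Laplace transform: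
measurable, integrable on `(0,R)` for all `R > 0`, and
`∫₀^∞ e^{−xu} |φ(u)| du < ∞` for every `x > 0`. -/
def MemDL (φ : ℝ → ℂ) : Prop :=
  Measurable φ ∧
  (∀ R > 0, IntegrableOn φ (Ioo 0 R)) ∧
  (∀ x > 0, IntegrableOn (fun u => Real.exp (-(x * u)) * ‖φ u‖) (Ioi 0))

/-- The forward difference operator with step `h`: `(Δ_h f)(t) = f(t+h) − f(t)`. -/
def Dh (h : ℝ) (f : ℝ → ℂ) : ℝ → ℂ := fun t => f (t + h) - f t

/-- The `n`-th term of the Bernoulli-operator series: `(−1)^n (Δ_h^n f)(t)/(n+1)`. -/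
def BTerm (h : ℝ) (f : ℝ → ℂ) (n : ℕ) (t : ℝ) : ℂ :=
  ((-1 : ℂ) ^ n / (n + 1)) * (Dh h)^[n] f t

/-- The Bernoulli operator `(B_h f)(t) = Σ_{n≥0} (−1)^n (Δ_h^n f)(t)/(n+1)`. -/
def Bop (h : ℝ) (f : ℝ → ℂ) (t : ℝ) : ℂ := ∑' n : ℕ, BTerm h f n t

/-- Generalized binomial coefficient `binom(h,n) = h(h−1)⋯(h−n+1)/n!`. -/
def gbinom (h : ℝ) (n : ℕ) : ℝ :=
  (∏ i ∈ Finset.range n, (h - i)) / n.factorial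

/-- The `n`-th term of the Newton series: `binom(h,n) (Δ^n f)(t)`. -/
def NTerm (h : ℝ) (f : ℝ → ℂ) (n : ℕ) (t : ℝ) : ℂ :=
  (gbinom h n : ℂ) * (Dh 1)^[n] f t

/-- The fractional shift `(E^h f)(t) = Σ_{n≥0} binom(h,n) (Δ^n f)(t)`. -/
def Nop (h : ℝ) (f : ℝ → ℂ) (t : ℝ) : ℂ := ∑' n : ℕ, NTerm h f n t

/-- The series `Σ g n` converges absolutely (pointwise on `S`) and its partial sums
converge locally uniformly on `S`. -/
def ALUOn (g : ℕ → ℝ → ℂ) (S : Set ℝ) : Prop :=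
  (∀ t ∈ S, Summable fun n : ℕ => ‖g n t‖) ∧
  TendstoLocallyUniformlyOn (fun N t => ∑ n ∈ Finset.range N, g n t)
    (fun t => ∑' n : ℕ, g n t) atTop S

/-- The Laplace–Mellin transform `f_{−s}(t) = (1/Γ(s)) ∫₀^∞ e^{−tu} φ(u) u^{s−1} du`. -/
def LM (φ : ℝ → ℂ) (s : ℂ) (t : ℝ) : ℂ :=
  (1 / Complex.Gamma s) *
    ∫ u in Ioi (0:ℝ), Complex.exp (-(t * u : ℝ)) * φ u * (u : ℂ) ^ (s - 1)

/-- `φ(u) = o(u^γ)` as `u → 0⁺`, i.e. `|φ(u)| u^{−Re γ} → 0`. -/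
def SmallO (φ : ℝ → ℂ) (γ : ℂ) : Prop :=
  Tendsto (fun u : ℝ => ‖φ u‖ * u ^ (-γ.re)) (nhdsWithin 0 (Ioi 0)) (nhds 0)

/-- Membership in `𝒟^ι(ℒ)`: `φ ∈ 𝒟(ℒ)` dominated by a nondecreasing `ψ ∈ 𝒟(ℒ)`. -/
def MemDLi (φ : ℝ → ℂ) : Prop :=
  MemDL φ ∧ ∃ ψ : ℝ → ℝ, MemDL (fun u => (ψ u : ℂ)) ∧ MonotoneOn ψ (Ioi 0) ∧
    ∀ u ∈ Ioi (0:ℝ), ‖φ u‖ ≤ ψ u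

/-- Membership in the class `ℋ`, with the witness `φ` recorded:
(1) `t ↦ f(s,t)` differentiable on `(0,∞)`;
(2) `s ↦ f(s,t)` and `s ↦ ∂ₜf(s,t)` entire;
(3) `f(−1,·) = ℒ(φ)` with `φ ∈ 𝒟^ι(ℒ)`;
(4) `f(−s,t)` is the Laplace–Mellin transform of `φ` for `Re s > 1`. -/
def MemHwith (f : ℂ → ℝ → ℂ) (φ : ℝ → ℂ) : Prop :=
  (∀ s : ℂ, ∀ t ∈ Ioi (0:ℝ), DifferentiableAt ℝ (f s) t) ∧
  (∀ t ∈ Ioi (0:ℝ), Differentiable ℂ fun s => f s t) ∧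
  (∀ t ∈ Ioi (0:ℝ), Differentiable ℂ fun s => deriv (f s) t) ∧
  MemDLi φ ∧
  (∀ t ∈ Ioi (0:ℝ), f (-1) t = Lap φ t) ∧
  (∀ s : ℂ, 1 < s.re → ∀ t ∈ Ioi (0:ℝ), f (-s) t = LM φ s t)

/-- Membership in the class `ℋ`. -/
def MemH (f : ℂ → ℝ → ℂ) : Prop := ∃ φ : ℝ → ℂ, MemHwith f φ

/-- The Hurwitz zeta function `ζ(s,x)` for real `x > 0`: the meromorphic continuation in `s`
of `Σ_{k≥0} (k+x)^{−s}`, expressed via Mathlib's `HurwitzZeta.hurwitzZeta` on `ℝ/ℤ`. -/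
def hurwitz (s : ℂ) (x : ℝ) : ℂ :=
  HurwitzZeta.hurwitzZeta (↑x : UnitAddCircle) s -
    ∑ k ∈ Finset.range ⌊x⌋₊,
      (if (k : ℝ) + Int.fract x = 0 then 0
       else (((k : ℝ) + Int.fract x : ℝ) : ℂ) ^ (-s))

end

lemma gbinom_succ (h : ℝ) (n : ℕ) : gbinom h (n + 1) * (n + 1) = gbinom h n * (h - n) := by
  simp only [gbinom, Finset.prod_range_succ, Nat.factorial_succ]
  have : (n.factorial : ℝ) ≠ 0 := by positivity
  push_cast
  field_simp

lemma summable_abs_gbinom {h : ℝ} (hh : 0 < h) : Summable fun n => |gbinom h n| := by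
  obtain ⟨M, hM⟩ := exists_nat_ge h
  have step : ∀ k : ℕ, h * |gbinom h (k + M)| =
      (k + M : ℕ) * |gbinom h (k + M)| - (k + 1 + M : ℕ) * |gbinom h (k + 1 + M)| := by
    intro k
    have h1 := congrArg abs (gbinom_succ h (k + M))
    rw [abs_mul, abs_mul] at h1
    have h2 : h - (k + M : ℕ) ≤ 0 := by
      push_cast
      have : (0 : ℝ) ≤ k := by positivity
      linarith
    rw [abs_of_nonpos h2, abs_of_nonneg (a := ((k + M : ℕ) : ℝ) + 1) (by positivity)] at h1
    rw [show k + 1 + M = k + M + 1 by ring, Nat.cast_succ,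
      mul_comm (((k + M : ℕ) : ℝ) + 1), h1]
    ring
  have hs : Summable fun k => h * |gbinom h (k + M)| := by
    refine summable_of_sum_range_le (c := M * |gbinom h M|) (fun k => by positivity) fun n => ?_
    rw [Finset.sum_congr rfl fun k _ => step k,
      Finset.sum_range_sub' (fun k : ℕ => ((k + M : ℕ) : ℝ) * |gbinom h (k + M)|)]
    have : (0 : ℝ) ≤ ((n + M : ℕ) : ℝ) * |gbinom h (n + M)| := by positivity
    simpa using this
  exact (summable_nat_add_iff M).1 ((summable_mul_left_iff hh.ne').1 hs)

lemma gbinom_eq_choose (h : ℝ) (n : ℕ) : gbinom h n = Ring.choose h n := by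
  induction n with
  | zero => simp [gbinom]
  | succ n ih =>
    have hn : ((n : ℝ) + 1) ≠ 0 := by positivity
    apply mul_right_cancel₀ hn
    rw [gbinom_succ, ih]
    simp only [Ring.choose_eq_smul, descPochhammer_succ_right, Nat.factorial_succ,
      Polynomial.smeval_mul, Polynomial.smeval_sub, Polynomial.smeval_X,
      Polynomial.smeval_natCast, smul_eq_mul]
    have : (n.factorial : ℝ) ≠ 0 := by positivity
    push_cast
    field_simp
    simp

lemma hasSum_gbinom_mul_pow (h : ℝ) {x : ℝ} (hx : |x| < 1) :
    HasSum (fun n => gbinom h n * x ^ n) ((1 + x) ^ h) := by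
  have := (Real.one_add_rpow_hasFPowerSeriesOnBall_zero (a := h)).hasSum (y := x) (by
    rw [← ENNReal.ofReal_one, Metric.eball_ofReal]
    simpa using hx)
  simpa [gbinom_eq_choose, binomialSeries, mul_comm] using this

lemma one_sub_exp_neg_mem {u : ℝ} (hu : 0 < u) :
    0 < 1 - Real.exp (-u) ∧ 1 - Real.exp (-u) < 1 ∧ 1 - Real.exp (-u) ≤ u := by
  have h1 : Real.exp (-u) < 1 := Real.exp_lt_one_iff.2 (by linarith)
  have h2 := Real.exp_pos (-u)
  have h3 := Real.add_one_le_exp (-u)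
  exact ⟨by linarith, by linarith, by linarith⟩

lemma abs_exp_sub_sum_gbinom_le {h : ℝ} (hh : 0 < h) {M N : ℕ} (hMN : M ≤ N) {u : ℝ}
    (hu : 0 < u) :
    |Real.exp (-(h * u)) - ∑ n ∈ Finset.range N, gbinom h n * (Real.exp (-u) - 1) ^ n| ≤
      (∑' n, |gbinom h (n + N)|) * (1 - Real.exp (-u)) ^ M := by
  obtain ⟨h0, h1, -⟩ := one_sub_exp_neg_mem hu
  have hx : |Real.exp (-u) - 1| = 1 - Real.exp (-u) := by
    rw [abs_sub_comm, abs_of_pos h0]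
  have hs := hasSum_gbinom_mul_pow h (x := Real.exp (-u) - 1) (by rw [hx]; exact h1)
  have he : (1 + (Real.exp (-u) - 1)) ^ h = Real.exp (-(h * u)) := by
    rw [add_sub_cancel, ← Real.exp_mul]; ring_nf
  rw [he] at hs
  have ht := (hasSum_nat_add_iff' N).2 hs
  rw [← ht.tsum_eq, ← tsum_mul_right, ← Real.norm_eq_abs]
  refine tsum_of_norm_bounded
    (((summable_nat_add_iff N).2 (summable_abs_gbinom hh)).mul_right _).hasSum fun n => ?_
  rw [Real.norm_eq_abs, abs_mul, abs_pow, hx]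
  exact mul_le_mul_of_nonneg_left (pow_le_pow_of_le_one h0.le h1.le (by omega)) (abs_nonneg _)

lemma MemDLi.exists_norm_le_exp {φ : ℝ → ℂ} (hφ : MemDLi φ) {ε : ℝ} (hε : 0 < ε) :
    ∃ C, ∀ u > 0, ‖φ u‖ ≤ C * Real.exp (ε * u) := by
  obtain ⟨-, ψ, ⟨-, -, hψ⟩, hmono, hle⟩ := hφ
  have hψ0 : ∀ u > 0, 0 ≤ ψ u := fun u hu => (norm_nonneg _).trans (hle u hu)
  have hint := hψ ε hε
  refine ⟨ε * ∫ v in Ioi (0 : ℝ), Real.exp (-(ε * v)) * ‖(ψ v : ℂ)‖, fun u hu => ?_⟩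
  have h1 : ∫ v in Ioi u, Real.exp (-ε * v) * ψ u ≤
      ∫ v in Ioi (0 : ℝ), Real.exp (-(ε * v)) * ‖(ψ v : ℂ)‖ := by
    refine le_trans ?_ (setIntegral_mono_set hint
      (Eventually.of_forall fun v => by positivity) (Ioi_subset_Ioi hu.le).eventuallyLE)
    refine setIntegral_mono_on
      ((integrableOn_exp_mul_Ioi (by linarith) u).mul_const _)
      (hint.mono_set (Ioi_subset_Ioi hu.le)) measurableSet_Ioi fun v hv => ?_
    have hv0 : 0 < v := hu.trans hv
    rw [Complex.norm_real, Real.norm_of_nonneg (hψ0 v hv0), neg_mul]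
    exact mul_le_mul_of_nonneg_left (hmono hu hv0 (le_of_lt hv)) (Real.exp_pos _).le
  rw [integral_mul_const, integral_exp_mul_Ioi (by linarith)] at h1
  have h2 : ψ u = ε * (-Real.exp (-ε * u) / -ε * ψ u) * Real.exp (ε * u) := by
    rw [neg_mul, Real.exp_neg]
    have := Real.exp_pos (ε * u)
    field_simp
  calc ‖φ u‖ ≤ ψ u := hle u hu
    _ = _ := h2
    _ ≤ _ := by gcongr

/-- The Mellin transform is holomorphic on `-N < re s` for functions vanishing to order `N` at `0`
and decaying exponentially. -/
lemma mellin_of_norm_le_exp {F : ℝ → ℂ} (hF : Measurable F) {C t : ℝ} (ht : 0 < t) {N : ℕ}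
    (hb : ∀ u > 0, ‖F u‖ ≤ C * (Real.exp (-t * u) * (1 - Real.exp (-u)) ^ N)) {s : ℂ}
    (hs : -(N : ℝ) < s.re) :
    MellinConvergent F s ∧ DifferentiableAt ℂ (mellin F) s := by
  have hC : 0 ≤ C := by
    have h1 := (norm_nonneg _).trans (hb 1 one_pos)
    have h2 := (one_sub_exp_neg_mem one_pos).1
    exact nonneg_of_mul_nonneg_left h1 (by positivity)
  have hb' : ∀ u > 0, ‖F u‖ ≤ C * Real.exp (-t * u) := fun u hu => by
    obtain ⟨h0, h1, -⟩ := one_sub_exp_neg_mem hu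
    refine (hb u hu).trans (mul_le_mul_of_nonneg_left ?_ hC)
    exact mul_le_of_le_one_right (Real.exp_pos _).le (pow_le_one₀ h0.le h1.le)
  have hint : IntegrableOn F (Ioi 0) := by
    refine Integrable.mono' ((integrableOn_exp_mul_Ioi (a := -t) (by linarith) 0).const_mul C)
      hF.aestronglyMeasurable ?_
    exact (ae_restrict_iff' measurableSet_Ioi).2 (Eventually.of_forall fun u hu => hb' u hu)
  have htop : F =O[atTop] (fun u : ℝ => u ^ (-(s.re + 1))) := by
    refine Asymptotics.IsBigO.trans ?_ (isLittleO_exp_neg_mul_rpow_atTop ht _).isBigO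
    refine Asymptotics.IsBigO.of_bound C ?_
    filter_upwards [eventually_gt_atTop 0] with u hu
    rw [Real.norm_of_nonneg (Real.exp_pos _).le]
    exact hb' u hu
  have hbot : F =O[nhdsWithin 0 (Ioi 0)] (fun u : ℝ => u ^ (-(-(N : ℝ)))) := by
    refine Asymptotics.IsBigO.of_bound C ?_
    filter_upwards [self_mem_nhdsWithin] with u hu
    have hu : 0 < u := hu
    obtain ⟨h0, h1, h2⟩ := one_sub_exp_neg_mem hu
    rw [neg_neg, Real.rpow_natCast, Real.norm_of_nonneg (by positivity)]
    refine (hb u hu).trans (mul_le_mul_of_nonneg_left ?_ hC)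
    refine (mul_le_of_le_one_left (by positivity) ?_).trans (pow_le_pow_left₀ h0.le h2 N)
    exact Real.exp_le_one_iff.2 (by nlinarith)
  exact ⟨mellinConvergent_of_isBigO_rpow hint.locallyIntegrableOn htop (by linarith) hbot hs,
    mellin_differentiableAt_of_isBigO_rpow hint.locallyIntegrableOn htop (by linarith) hbot hs⟩

lemma LM_eq_mellin (φ : ℝ → ℂ) (s : ℂ) (t : ℝ) :
    LM φ s t =
      (Complex.Gamma s)⁻¹ * mellin (fun u => Complex.exp (-(t * u : ℝ)) * φ u) s := by
  simp [LM, mellin, mul_comm]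

lemma measurable_exp_mul {φ : ℝ → ℂ} (hφ : Measurable φ) (t : ℝ) :
    Measurable fun u : ℝ => Complex.exp (-(t * u : ℝ)) * φ u := by
  have : Measurable fun u : ℝ => Complex.exp (-(t * u : ℝ)) := by fun_prop
  exact this.mul hφ

lemma norm_cexp_neg (x : ℝ) : ‖Complex.exp (-(x : ℂ))‖ = Real.exp (-x) := by
  simp [Complex.norm_exp]

lemma MemDLi.mellin_weighted {φ g : ℝ → ℂ} (hφ : MemDLi φ) (hg : Measurable g) {C : ℝ} {N : ℕ}
    (hb : ∀ u > 0, ‖g u‖ ≤ C * (1 - Real.exp (-u)) ^ N) {t : ℝ} (ht : 0 < t) {s : ℂ}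
    (hs : -(N : ℝ) < s.re) :
    MellinConvergent (fun u => Complex.exp (-(t * u : ℝ)) * (g u * φ u)) s ∧
      DifferentiableAt ℂ (mellin fun u => Complex.exp (-(t * u : ℝ)) * (g u * φ u)) s := by
  obtain ⟨D, hD⟩ := hφ.exists_norm_le_exp (half_pos ht)
  refine mellin_of_norm_le_exp (C := C * D) (t := t / 2)
    (measurable_exp_mul (hg.mul hφ.1.1) t) (half_pos ht) (fun u hu => ?_) hs
  rw [Pi.mul_apply, norm_mul, norm_mul, norm_cexp_neg]
  have hexp : Real.exp (-(t / 2) * u) = Real.exp (-(t * u)) * Real.exp (t / 2 * u) := by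
    rw [← Real.exp_add]; ring_nf
  rw [hexp]
  calc Real.exp (-(t * u)) * (‖g u‖ * ‖φ u‖)
      ≤ Real.exp (-(t * u)) *
          ((C * (1 - Real.exp (-u)) ^ N) * (D * Real.exp (t / 2 * u))) := by
        have := hb u hu
        have := hD u hu
        have := (norm_nonneg _).trans (hb u hu)
        gcongr
    _ = _ := by ring

/-- `G (-s)` is, for `1 < re s`, the Laplace–Mellin transform of `g * φ` with `g` bounded,
and `G` is entire in its first variable. -/
def IsWeightedLM (φ : ℝ → ℂ) (G : ℂ → ℝ → ℂ) (g : ℝ → ℂ) : Prop :=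
  Measurable g ∧ (∃ C, ∀ u > 0, ‖g u‖ ≤ C) ∧
  (∀ t > 0, Differentiable ℂ fun s => G s t) ∧
  ∀ s : ℂ, 1 < s.re → ∀ t > 0, G (-s) t = LM (fun u => g u * φ u) s t

namespace IsWeightedLM

variable {φ : ℝ → ℂ} {G G' : ℂ → ℝ → ℂ} {g g' : ℝ → ℂ}

lemma mellinConvergent (hφ : MemDLi φ) (hG : IsWeightedLM φ G g) {s : ℂ} (hs : 1 < s.re)
    {t : ℝ} (ht : 0 < t) :
    MellinConvergent (fun u => Complex.exp (-(t * u : ℝ)) * (g u * φ u)) s := by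
  obtain ⟨hg, ⟨C, hC⟩, -, -⟩ := hG
  refine (hφ.mellin_weighted hg (C := C) (N := 0) (by simpa using hC) ht ?_).1
  simp only [Nat.cast_zero]
  linarith

lemma add (hφ : MemDLi φ) (hG : IsWeightedLM φ G g) (hG' : IsWeightedLM φ G' g') :
    IsWeightedLM φ (fun s t => G s t + G' s t) (fun u => g u + g' u) := by
  have hc := @mellinConvergent φ G g hφ hG
  have hc' := @mellinConvergent φ G' g' hφ hG'
  obtain ⟨hg, ⟨C, hC⟩, hd, he⟩ := hG
  obtain ⟨hg', ⟨C', hC'⟩, hd', he'⟩ := hG'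
  refine ⟨hg.add hg', ⟨C + C', fun u hu => norm_add_le_of_le (hC u hu) (hC' u hu)⟩,
    fun t ht => (hd t ht).add (hd' t ht), fun s hs t ht => ?_⟩
  have h := (hasMellin_add (hc hs ht) (hc' hs ht)).2
  beta_reduce
  rw [he s hs t ht, he' s hs t ht, LM_eq_mellin, LM_eq_mellin, LM_eq_mellin, ← mul_add, ← h]
  congr 2
  ext u
  ring

lemma const_mul (hG : IsWeightedLM φ G g) (c : ℂ) :
    IsWeightedLM φ (fun s t => c * G s t) (fun u => c * g u) := by
  obtain ⟨hg, ⟨C, hC⟩, hd, he⟩ := hG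
  refine ⟨hg.const_mul c, ⟨‖c‖ * C, fun u hu => ?_⟩, fun t ht => (hd t ht).const_mul c,
    fun s hs t ht => ?_⟩
  · rw [norm_mul]
    exact mul_le_mul_of_nonneg_left (hC u hu) (norm_nonneg c)
  · beta_reduce
    rw [he s hs t ht, LM_eq_mellin, LM_eq_mellin, mul_left_comm, ← smul_eq_mul c,
      ← mellin_const_smul]
    congr 2
    ext u
    simp only [smul_eq_mul]
    ring

lemma sub (hφ : MemDLi φ) (hG : IsWeightedLM φ G g) (hG' : IsWeightedLM φ G' g') :
    IsWeightedLM φ (fun s t => G s t - G' s t) (fun u => g u - g' u) := by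
  simpa [sub_eq_add_neg] using hG.add hφ (hG'.const_mul (-1))

lemma shift (hG : IsWeightedLM φ G g) {a : ℝ} (ha : 0 ≤ a) :
    IsWeightedLM φ (fun s t => G s (t + a)) (fun u => (Real.exp (-(a * u)) : ℂ) * g u) := by
  obtain ⟨hg, ⟨C, hC⟩, hd, he⟩ := hG
  have hm : Measurable fun u : ℝ => (Real.exp (-(a * u)) : ℂ) := by fun_prop
  refine ⟨hm.mul hg, ⟨C, fun u hu => ?_⟩, fun t ht => hd (t + a) (by positivity),
    fun s hs t ht => ?_⟩
  · rw [norm_mul, Complex.norm_real, Real.norm_of_nonneg (Real.exp_pos _).le]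
    refine (mul_le_of_le_one_left (norm_nonneg _) (Real.exp_le_one_iff.2 ?_)).trans (hC u hu)
    have := mul_nonneg ha hu.le
    linarith
  · beta_reduce
    rw [he s hs (t + a) (by positivity), LM_eq_mellin, LM_eq_mellin]
    congr 2
    ext u
    rw [← mul_assoc, ← mul_assoc, ← mul_assoc, Complex.ofReal_exp, ← Complex.exp_add]
    congr 3
    push_cast
    ring

lemma iterate_Dh (hφ : MemDLi φ) (hG : IsWeightedLM φ G g) (n : ℕ) :
    IsWeightedLM φ (fun s => (Dh 1)^[n] (G s))
      (fun u => ((Real.exp (-u) : ℂ) - 1) ^ n * g u) := by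
  induction n with
  | zero => simpa using hG
  | succ n ih =>
    have h := (ih.shift zero_le_one).sub hφ ih
    convert h using 1
    · ext s t
      rw [Function.iterate_succ_apply']
      rfl
    · ext u
      rw [one_mul]
      ring

lemma sum (hφ : MemDLi φ) {G : ℕ → ℂ → ℝ → ℂ} {g : ℕ → ℝ → ℂ}
    (hG : ∀ n, IsWeightedLM φ (G n) (g n)) (N : ℕ) :
    IsWeightedLM φ (fun s t => ∑ n ∈ Finset.range N, G n s t)
      (fun u => ∑ n ∈ Finset.range N, g n u) := by
  induction N with
  | zero => simpa using (hG 0).const_mul 0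
  | succ N ih =>
    simp only [Finset.sum_range_succ]
    exact ih.add hφ (hG N)

/-- If the weight vanishes to order `N` at `0`, the Laplace–Mellin representation extends to
`-N < re s`. -/
lemma eq_LM (hφ : MemDLi φ) (hG : IsWeightedLM φ G g) {C : ℝ} {N : ℕ}
    (hb : ∀ u > 0, ‖g u‖ ≤ C * (1 - Real.exp (-u)) ^ N) {s : ℂ} (hs : -(N : ℝ) < s.re)
    {t : ℝ} (ht : 0 < t) : G (-s) t = LM (fun u => g u * φ u) s t := by
  obtain ⟨hg, -, hd, he⟩ := hG
  set U : Set ℂ := {z | -(N : ℝ) < z.re}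
  have hU : IsOpen U := isOpen_lt continuous_const Complex.continuous_re
  have hUc : IsPreconnected U := (convex_halfSpace_re_gt _).isPreconnected
  have h1 : AnalyticOnNhd ℂ (fun s => G (-s) t) U :=
    ((hd t ht).comp differentiable_neg).differentiableOn.analyticOnNhd hU
  have h2 : AnalyticOnNhd ℂ (fun s => LM (fun u => g u * φ u) s t) U := by
    refine DifferentiableOn.analyticOnNhd (fun z hz => ?_) hU
    simp only [LM_eq_mellin]
    exact ((Complex.differentiable_one_div_Gamma z).mul
      (hφ.mellin_weighted hg hb ht hz).2).differentiableWithinAt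
  refine h1.eqOn_of_preconnected_of_eventuallyEq h2 hUc (z₀ := 2) ?_ ?_ hs
  · have : (0 : ℝ) ≤ N := N.cast_nonneg
    simp only [U, mem_ofPred_eq, Complex.re_ofNat]
    linarith
  · have : {z : ℂ | 1 < z.re} ∈ nhds (2 : ℂ) :=
      (isOpen_lt continuous_const Complex.continuous_re).mem_nhds (by simp)
    filter_upwards [this] with z hz using he z hz t ht

end IsWeightedLM

/-- Quantitative bound, uniform over all weights vanishing to order `N` and over `t ≥ a`. -/
lemma MemDLi.exists_bound {φ : ℝ → ℂ} (hφ : MemDLi φ) {N : ℕ} {s : ℂ} (hs : -(N : ℝ) < s.re)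
    {a : ℝ} (ha : 0 < a) :
    ∃ K : ℝ, ∀ (G : ℂ → ℝ → ℂ) (g : ℝ → ℂ) (C : ℝ), IsWeightedLM φ G g →
      (∀ u > 0, ‖g u‖ ≤ C * (1 - Real.exp (-u)) ^ N) →
      ∀ t ≥ a, ‖G (-s) t‖ ≤ C * K := by
  set w : ℝ → ℂ := fun u => ((1 - Real.exp (-u) : ℝ) : ℂ) ^ N
  have hw : Measurable w := by fun_prop
  have hwn : ∀ u > 0, ‖w u‖ = (1 - Real.exp (-u)) ^ N := fun u hu => by
    rw [norm_pow, Complex.norm_real, Real.norm_of_nonneg (one_sub_exp_neg_mem hu).1.le]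
  have hconv := (hφ.mellin_weighted hw (C := 1) (N := N) (fun u hu => by
    rw [hwn u hu, one_mul]) ha hs).1
  refine ⟨‖(Complex.Gamma s)⁻¹‖ * ∫ u in Ioi (0 : ℝ),
    ‖(u : ℂ) ^ (s - 1) • (Complex.exp (-(a * u : ℝ)) * (w u * φ u))‖,
    fun G g C hG hb t ht => ?_⟩
  rw [hG.eq_LM hφ hb hs (ha.trans_le ht), LM_eq_mellin, norm_mul, mul_left_comm,
    ← integral_const_mul]
  refine mul_le_mul_of_nonneg_left ?_ (norm_nonneg _)
  refine norm_integral_le_of_norm_le (hconv.norm.const_mul C) ?_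
  refine (ae_restrict_iff' measurableSet_Ioi).2 (Eventually.of_forall fun u hu => ?_)
  have hu : 0 < u := hu
  rw [norm_smul, norm_smul, norm_mul, norm_mul, norm_mul, norm_mul, norm_cexp_neg, norm_cexp_neg,
    hwn u hu]
  calc ‖(u : ℂ) ^ (s - 1)‖ * (Real.exp (-(t * u)) * (‖g u‖ * ‖φ u‖))
      ≤ ‖(u : ℂ) ^ (s - 1)‖ *
          (Real.exp (-(a * u)) * ((C * (1 - Real.exp (-u)) ^ N) * ‖φ u‖)) := by
        have := hb u hu
        gcongr
    _ = _ := by ring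

lemma MemHwith.isWeightedLM {f : ℂ → ℝ → ℂ} {φ : ℝ → ℂ} (hf : MemHwith f φ) :
    IsWeightedLM φ f fun _ => 1 := by
  obtain ⟨-, hd, -, -, -, he⟩ := hf
  exact ⟨measurable_const, ⟨1, by simp⟩, hd, by simpa using he⟩

/-- for `f ∈ ℋ` and `h > 0`, for every `s ∈ ℂ` the Newton series
`(E^h f_s)(t) = Σ_{n≥0} binom(h,n) (Δ^n f_s)(t)` converges absolutely and locally uniformly
on `(0,∞)` and equals `f(s, t+h)` for each `t > 0`. -/
theorem stmt9 (f : ℂ → ℝ → ℂ) (hf : MemH f) (h : ℝ) (hh : 0 < h) :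
    ∀ s : ℂ,
      ALUOn (NTerm h (f s)) (Ioi 0) ∧
      ∀ t ∈ Ioi (0:ℝ), Nop h (f s) t = f s (t + h) := by
  intro s
  obtain ⟨φ, hf⟩ := hf
  have hφ : MemDLi φ := hf.2.2.2.1
  have hrep := hf.isWeightedLM
  obtain ⟨M, hM⟩ := exists_nat_gt s.re
  have hs : -(M : ℝ) < (-s).re := by simpa using hM
  have hterm : ∀ n, IsWeightedLM φ (fun s => NTerm h (f s) n)
      (fun u => (gbinom h n : ℂ) * (((Real.exp (-u) : ℂ) - 1) ^ n * 1)) := fun n =>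
    (hrep.iterate_Dh hφ n).const_mul _
  have hrem : ∀ N, IsWeightedLM φ
      (fun s t => f s (t + h) - ∑ n ∈ Finset.range N, NTerm h (f s) n t) _ := fun N =>
    (hrep.shift hh.le).sub hφ (IsWeightedLM.sum hφ hterm N)
  have hsb := summable_abs_gbinom hh
  have hbound : ∀ a > 0, ∃ K, ∀ t ≥ a, ∀ n ≥ M,
      ‖NTerm h (f s) n t‖ ≤ |gbinom h n| * K ∧
      ‖f s (t + h) - ∑ k ∈ Finset.range n, NTerm h (f s) k t‖ ≤
        (∑' k, |gbinom h (k + n)|) * K := by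
    intro a ha
    obtain ⟨K, hK⟩ := hφ.exists_bound hs ha
    refine ⟨K, fun t ht n hn => ⟨?_, ?_⟩⟩
    · have := hK _ _ |gbinom h n| (hterm n) (fun u hu => ?_) t ht
      · simpa using this
      · obtain ⟨h0, h1, -⟩ := one_sub_exp_neg_mem hu
        rw [mul_one, norm_mul, norm_pow, Complex.norm_real, Real.norm_eq_abs, norm_sub_rev,
          ← Complex.ofReal_one, ← Complex.ofReal_sub, Complex.norm_real,
          Real.norm_of_nonneg h0.le]
        exact mul_le_mul_of_nonneg_left (pow_le_pow_of_le_one h0.le h1.le hn) (abs_nonneg _)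
    · have := hK _ _ (∑' k, |gbinom h (k + n)|) (hrem n) (fun u hu => ?_) t ht
      · simpa using this
      · have := abs_exp_sub_sum_gbinom_le hh hn hu
        rw [← Real.norm_eq_abs, ← Complex.norm_real] at this
        simpa using this
  have hsum : ∀ t > 0, Summable fun n => ‖NTerm h (f s) n t‖ := by
    intro t ht
    obtain ⟨K, hK⟩ := hbound t ht
    rw [← summable_nat_add_iff M]
    exact Summable.of_nonneg_of_le (fun n => norm_nonneg _)
      (fun n => (hK t le_rfl (n + M) (by omega)).1)
      ((summable_nat_add_iff M).2 (hsb.mul_right K))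
  have hunif : ∀ a > 0, TendstoUniformlyOn
      (fun N t => ∑ n ∈ Finset.range N, NTerm h (f s) n t) (fun t => f s (t + h)) atTop
      (Ici a) := by
    intro a ha
    obtain ⟨K, hK⟩ := hbound a ha
    rw [Metric.tendstoUniformlyOn_iff]
    intro ε hε
    have hlim : Tendsto (fun n => (∑' k, |gbinom h (k + n)|) * K) atTop (nhds 0) := by
      simpa using (tendsto_sum_nat_add fun n => |gbinom h n|).mul_const K
    filter_upwards [hlim.eventually_lt_const hε, eventually_ge_atTop M] with n hn hnM t ht
    rw [dist_eq_norm]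
    exact ((hK t ht n hnM).2).trans_lt hn
  have heq : ∀ t ∈ Ioi (0 : ℝ), ∑' n, NTerm h (f s) n t = f s (t + h) := fun t ht =>
    tendsto_nhds_unique (hsum t ht).of_norm.hasSum.tendsto_sum_nat
      ((hunif t ht).tendsto_at self_mem_Ici)
  refine ⟨⟨hsum, ?_⟩, heq⟩
  refine TendstoLocallyUniformlyOn.congr_right ?_ fun t ht => (heq t ht).symm
  intro v hv t ht
  have ht : 0 < t := ht
  exact ⟨Ici (t / 2), mem_nhdsWithin_of_mem_nhds (Ici_mem_nhds (by linarith)),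
    hunif (t / 2) (by linarith) v hv⟩
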